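/- Let p, q ∈ ℤ[X] be polynomials with natTrailingDegree p < natDegree p and natTrailingDegree q < natDegree q, and suppose the leading and trailing coefficients of p and of q all have absolute value 1. For a nonzero polynomial r ∈ ℤ[X] define T(r) := |coeff of r in degree natDegree r − 1| + |coeff of r in degree natTrailingDegree r + 1|. Then T(p·q) ≤ T(p) + T(q). -/

import Mathlib

open Polynomial

/-- `T r` is the sum of the absolute values of the second and penultimate
coefficients of the integer polynomial `r`. -/
def jonesT (r : Polynomial ℤ) : ℤ :=
  |r.coeff (r.natDegree - 1)| + |r.coeff (r.natTrailingDegree + 1)|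

theorem Polynomial.coeff_mul_add_one_of_forall_eq_zero {R : Type*} [Semiring R] (f g : R[X])
    (a b : ℕ)
    (h : ∀ i j, i + j = a + b + 1 → i ≠ a → i ≠ a + 1 → f.coeff i * g.coeff j = 0) :
    (f * g).coeff (a + b + 1) = f.coeff a * g.coeff (b + 1) + f.coeff (a + 1) * g.coeff b := by
  rw [coeff_mul]
  refine Finset.sum_eq_add (a, b + 1) (a + 1, b) (by simp) ?_ ?_ ?_
  · rintro ⟨i, j⟩ hij ⟨h₁, h₂⟩
    rw [Finset.HasAntidiagonal.mem_antidiagonal] at hij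
    simp only [ne_eq, Prod.mk.injEq] at hij h₁ h₂
    exact h i j hij (by omega) (by omega)
  · intro hn
    exact absurd (Finset.HasAntidiagonal.mem_antidiagonal.2 (by omega)) hn
  · intro hn
    exact absurd (Finset.HasAntidiagonal.mem_antidiagonal.2 (by omega)) hn

theorem Polynomial.coeff_mul_natTrailingDegree_add_natTrailingDegree_add_one {R : Type*}
    [Semiring R] (f g : R[X]) :
    (f * g).coeff (f.natTrailingDegree + g.natTrailingDegree + 1) =
      f.trailingCoeff * g.coeff (g.natTrailingDegree + 1) +
        f.coeff (f.natTrailingDegree + 1) * g.trailingCoeff := by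
  refine coeff_mul_add_one_of_forall_eq_zero f g _ _ fun i j hij h₁ h₂ => ?_
  rcases lt_or_ge i f.natTrailingDegree with hi | hi
  · rw [coeff_eq_zero_of_lt_natTrailingDegree hi, zero_mul]
  · rw [coeff_eq_zero_of_lt_natTrailingDegree (p := g) (by omega), mul_zero]

theorem Polynomial.coeff_mul_natDegree_add_natDegree_sub_one {R : Type*} [Semiring R]
    {f g : R[X]} (hf : 0 < f.natDegree) (hg : 0 < g.natDegree) :
    (f * g).coeff (f.natDegree + g.natDegree - 1) =
      f.coeff (f.natDegree - 1) * g.leadingCoeff + f.leadingCoeff * g.coeff (g.natDegree - 1) := by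
  obtain ⟨a, ha⟩ := Nat.exists_eq_add_one.2 hf
  obtain ⟨b, hb⟩ := Nat.exists_eq_add_one.2 hg
  have key := coeff_mul_add_one_of_forall_eq_zero f g a b fun i j hij h₁ h₂ => by
    rcases lt_or_ge (a + 1) i with hi | hi
    · rw [coeff_eq_zero_of_natDegree_lt (by omega), zero_mul]
    · rw [coeff_eq_zero_of_natDegree_lt (p := g) (by omega), mul_zero]
  rw [leadingCoeff, leadingCoeff, ha, hb, show a + 1 + (b + 1) - 1 = a + b + 1 by omega]
  exact key

theorem abs_mul_add_mul_le_of_abs_eq_one {R : Type*} [Ring R] [LinearOrder R]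
    [IsStrictOrderedRing R] {u v : R} (hu : |u| = 1) (hv : |v| = 1) (x y : R) :
    |x * v + u * y| ≤ |x| + |y| := by
  simpa [abs_mul, hu, hv] using abs_add_le (x * v) (u * y)

theorem jonesT_mul_le (p q : Polynomial ℤ)
    (hp : p.natTrailingDegree < p.natDegree)
    (hq : q.natTrailingDegree < q.natDegree)
    (hpl : |p.leadingCoeff| = 1) (hpt : |p.trailingCoeff| = 1)
    (hql : |q.leadingCoeff| = 1) (hqt : |q.trailingCoeff| = 1) :
    jonesT (p * q) ≤ jonesT p + jonesT q := by
  have hp₀ : p ≠ 0 := by rintro rfl; simp at hp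
  have hq₀ : q ≠ 0 := by rintro rfl; simp at hq
  unfold jonesT
  rw [natDegree_mul hp₀ hq₀, natTrailingDegree_mul hp₀ hq₀,
    coeff_mul_natDegree_add_natDegree_sub_one (by omega) (by omega),
    coeff_mul_natTrailingDegree_add_natTrailingDegree_add_one, add_comm (p.trailingCoeff * _)]
  have top := abs_mul_add_mul_le_of_abs_eq_one hpl hql
    (p.coeff (p.natDegree - 1)) (q.coeff (q.natDegree - 1))
  have bot := abs_mul_add_mul_le_of_abs_eq_one hpt hqt
    (p.coeff (p.natTrailingDegree + 1)) (q.coeff (q.natTrailingDegree + 1))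
  linarith
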